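/- arXiv:2309.01882 — 2 statements merged into one kernel-verified Lean document; each statement's English description precedes it below -/
import Mathlib

section
/- Let d ∈ ℕ, n ∈ ℕ, and let n̂ ∈ n S_d^o with p̂ := n̂/n, p̂_{d+1} := 1 − ‖p̂‖₁. The function p ↦ ½ δ_{n̂,p}ᵀ Σ_p^{−1} δ_{n̂,p} = (n/2) Σ_{i=1}^{d+1} (p̂_i − p_i)²/p_i is strictly convex on S_d^o; its Hessian in p equals n [ diag( (p̂_i²/p_i³)_{i=1}^d ) + (p̂_{d+1}²/p_{d+1}³) 1_d 1_dᵀ ], which is positive definite for p ∈ (0,∞)^d with ‖p‖₁ < 1 (here p_{d+1} := 1 − ‖p‖₁). -/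
open MeasureTheory Matrix Real Finset
open scoped BigOperators ENNReal NNReal

noncomputable section

/-- Extended probability vector: `p` on `Fin d`, together with `p (d+1) = 1 - ∑ p`. -/
def extP (d : ℕ) (p : Fin d → ℝ) : Fin (d + 1) → ℝ :=
  Fin.snoc p (1 - ∑ i, p i)

/-- Extended coordinate vector: `v` on `Fin d`, together with `v (d+1) = n - ∑ v`. -/
def extV (d n : ℕ) (v : Fin d → ℝ) : Fin (d + 1) → ℝ :=
  Fin.snoc v ((n : ℝ) - ∑ i, v i)

/-- `δ_{y,q} = (y - n q) / √n`. -/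
def del (n : ℕ) (q y : ℝ) : ℝ := (y - n * q) / Real.sqrt n

/-- The vector `δ_{v,p}`. -/
def delVec (d n : ℕ) (p v : Fin d → ℝ) : Fin d → ℝ := fun i => del n (p i) (v i)

/-- The covariance matrix `Σ_p = diag p - p pᵀ`. -/
def covM (d : ℕ) (p : Fin d → ℝ) : Matrix (Fin d) (Fin d) ℝ :=
  Matrix.diagonal p - Matrix.vecMulVec p p

/-- The quadratic form `x ↦ xᵀ Σ_p⁻¹ x`. -/
def quadForm (d : ℕ) (p x : Fin d → ℝ) : ℝ := x ⬝ᵥ ((covM d p)⁻¹ *ᵥ x)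

/-- The Gaussian density `φ_{Σ_p}`. -/
def gaussDens (d : ℕ) (p y : Fin d → ℝ) : ℝ :=
  Real.exp (-(1 / 2) * quadForm d p y) /
    Real.sqrt ((2 * Real.pi) ^ d * ∏ i, extP d p i)

/-- The `Multinomial(n, p)` probability mass function. -/
def multinomialPMF (d n : ℕ) (p : Fin d → ℝ) (k : Fin d → ℕ) : ℝ :=
  if ∑ i, k i ≤ n then
    ((n.factorial : ℝ) / ((∏ i, ((k i).factorial : ℝ)) * ((n - ∑ i, k i).factorial : ℝ))) *
      ((∏ i, p i ^ k i) * (1 - ∑ i, p i) ^ (n - ∑ i, k i))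
  else 0

/-- The interior `S_d^o` of the unit simplex. -/
def simplexInt (d : ℕ) : Set (Fin d → ℝ) :=
  {s | (∀ i, s i ∈ Set.Ioo (0 : ℝ) 1) ∧ ∑ i, s i < 1}

/-- The set `P_τ`. -/
def Ptau (d : ℕ) (τ : ℝ) : Set (Fin d → ℝ) :=
  {s | s ∈ simplexInt d ∧ ∀ i : Fin (d + 1), (extP d s i)⁻¹ ≤ τ}

/-- Cast a vector of naturals to a real vector. -/
def castK (d : ℕ) (k : Fin d → ℕ) : Fin d → ℝ := fun i => (k i : ℝ)

/-- The bulk set `B_{n,p}` (integer vectors). -/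
def bulk (d n : ℕ) (τ : ℝ) (p : Fin d → ℝ) : Set (Fin d → ℕ) :=
  {k | (∀ i, 0 < k i) ∧ ∑ i, k i < n ∧
    ∀ i : Fin (d + 1),
      |del n (extP d p i) (extV d n (castK d k) i) / (Real.sqrt n * extP d p i)| ≤
        τ * Real.sqrt (Real.log n / n)}

/-- The bulk set `B_{n,p}` (real vectors). -/
def bulkReal (d n : ℕ) (τ : ℝ) (p : Fin d → ℝ) : Set (Fin d → ℝ) :=
  {x | ∀ i : Fin (d + 1),
    |del n (extP d p i) (extV d n x i) / (Real.sqrt n * extP d p i)| ≤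
      τ * Real.sqrt (Real.log n / n)}

/-- The main term in the local expansion. -/
def mainTerm (d n : ℕ) (p v : Fin d → ℝ) : ℝ :=
  (n : ℝ) ^ (-(1 : ℝ) / 2) * ∑ i : Fin (d + 1),
    (del n (extP d p i) (extV d n v i) ^ 3 / (6 * extP d p i ^ 2) -
      del n (extP d p i) (extV d n v i) / (2 * extP d p i))

/-- The bound on the remainder `R_{n,p}(k)`. -/
def errBound (d n : ℕ) (τ : ℝ) (p v : Fin d → ℝ) : ℝ :=
  (n : ℝ)⁻¹ * ∑ i : Fin (d + 1),
    (21 * |del n (extP d p i) (extV d n v i)| ^ 4 / extP d p i ^ 3 +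
      10 * |del n (extP d p i) (extV d n v i)| ^ 2 / extP d p i ^ 2 + 2 * τ / 3)

/-- The log-ratio of the multinomial pmf over the corresponding normal density. -/
def logRatio (d n : ℕ) (p : Fin d → ℝ) (k : Fin d → ℕ) : ℝ :=
  Real.log (multinomialPMF d n p k /
    ((n : ℝ) ^ (-(d : ℝ) / 2) * gaussDens d p (delVec d n p (castK d k))))

/-- The law of a `Multinomial(n,p)` random vector, as a measure on `ℝ^d`. -/
def multinomialLaw (d n : ℕ) (p : Fin d → ℝ) : Measure (Fin d → ℝ) :=
  Measure.sum fun k : Fin d → ℕ =>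
    ENNReal.ofReal (multinomialPMF d n p k) • Measure.dirac (castK d k)

/-- The law of a `Uniform(-1/2,1/2)^d` random vector. -/
def uniformBoxLaw (d : ℕ) : Measure (Fin d → ℝ) :=
  volume.restrict (Set.univ.pi fun _ : Fin d => Set.Ioo (-(1 : ℝ) / 2) (1 / 2))

/-- The law of a `Normal_d (n p, n Σ_p)` random vector. -/
def gaussLaw (d n : ℕ) (p : Fin d → ℝ) : Measure (Fin d → ℝ) :=
  volume.withDensity fun y =>
    ENNReal.ofReal ((n : ℝ) ^ (-(d : ℝ) / 2) * gaussDens d p (delVec d n p y))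

/-- The regularized lower incomplete gamma function `γ̄(x, a)`. -/
def regGamma (x a : ℝ) : ℝ :=
  (∫ t in (0 : ℝ)..a, t ^ (x - 1) * Real.exp (-t)) / Real.Gamma x

/-- The function `p ↦ ½ δ_{n̂,p}ᵀ Σ_p⁻¹ δ_{n̂,p}`. -/
def pearsonHalf (d n : ℕ) (nh : Fin d → ℕ) (p : Fin d → ℝ) : ℝ :=
  (1 / 2) * quadForm d p (delVec d n p (castK d nh))

/-- The claimed Hessian matrix `n [diag((p̂_i²/p_i³)_i) + (p̂_{d+1}²/p_{d+1}³) 1_d 1_dᵀ]`. -/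
def hessM (d n : ℕ) (nh : Fin d → ℕ) (p : Fin d → ℝ) : Matrix (Fin d) (Fin d) ℝ :=
  (n : ℝ) • (Matrix.diagonal (fun i => ((nh i : ℝ) / n) ^ 2 / p i ^ 3) +
    ((1 - ∑ i, (nh i : ℝ) / n) ^ 2 / (1 - ∑ i, p i) ^ 3) •
      Matrix.vecMulVec (fun _ => (1 : ℝ)) fun _ => 1)

/-- The Sherman–Morrison inverse of the multinomial covariance matrix. -/
lemma covM_inv {d : ℕ} {p : Fin d → ℝ} (hp : ∀ i, p i ≠ 0) (hs : 1 - ∑ i, p i ≠ 0) :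
    (covM d p)⁻¹ = Matrix.diagonal (fun i => (p i)⁻¹) +
      (1 - ∑ i, p i)⁻¹ • Matrix.vecMulVec (fun _ => 1) (fun _ => 1) := by
  apply Matrix.inv_eq_right_inv
  ext i j
  simp only [covM, Matrix.sub_mul, Matrix.mul_add, Matrix.diagonal_mul_diagonal,
    Matrix.mul_smul, Matrix.mul_vecMulVec, Matrix.vecMulVec_mul, Matrix.sub_mulVec, Matrix.vecMulVec_mulVec,
    Matrix.sub_apply, Matrix.add_apply, Matrix.smul_apply, Matrix.vecMulVec_apply,
    Matrix.mulVec_diagonal, Matrix.vecMul_diagonal, Matrix.diagonal_apply, Matrix.one_apply,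
    dotProduct, Pi.sub_apply, Pi.smul_apply, MulOpposite.smul_eq_mul_unop, MulOpposite.unop_op, smul_eq_mul,
    mul_one, mul_inv_cancel₀ (hp _)]
  field_simp
  ring

lemma quadForm_eq {d : ℕ} {p : Fin d → ℝ} (hp : ∀ i, p i ≠ 0) (hs : 1 - ∑ i, p i ≠ 0)
    (x : Fin d → ℝ) :
    quadForm d p x = ∑ i, x i ^ 2 / p i + (∑ i, x i) ^ 2 / (1 - ∑ i, p i) := by
  rw [quadForm, covM_inv hp hs, Matrix.add_mulVec, Matrix.smul_mulVec, Matrix.vecMulVec_mulVec,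
    dotProduct_add]
  congr 1
  · simp only [dotProduct, Matrix.mulVec_diagonal]
    exact Finset.sum_congr rfl fun i _ => by ring
  · simp only [dotProduct, Pi.smul_apply, MulOpposite.smul_eq_mul_unop, MulOpposite.unop_op,
      smul_eq_mul, one_mul, ← Finset.sum_mul]
    ring

/-- The weighted sum of the reciprocals of the `d + 1` coordinates of a probability vector. -/
def recipSum {d : ℕ} (c : Fin d → ℝ) (e : ℝ) (p : Fin d → ℝ) : ℝ :=
  ∑ i, c i * (p i)⁻¹ + e * (1 - ∑ i, p i)⁻¹

lemma mem_simplexInt_iff {d : ℕ} {p : Fin d → ℝ} :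
    p ∈ simplexInt d ↔ (∀ i, 0 < p i) ∧ ∑ i, p i < 1 := by
  refine ⟨fun h => ⟨fun i => (h.1 i).1, h.2⟩, fun h => ⟨fun i => ⟨h.1 i, ?_⟩, h.2⟩⟩
  exact (Finset.single_le_sum (fun j _ => (h.1 j).le) (Finset.mem_univ i)).trans_lt h.2

lemma isOpen_simplexInt (d : ℕ) : IsOpen (simplexInt d) := by
  have : simplexInt d = (⋂ i, {p | 0 < p i}) ∩ {p | ∑ i, p i < 1} := by
    ext p
    simp [mem_simplexInt_iff]
  rw [this]
  exact (isOpen_iInter_of_finite fun i => isOpen_lt (by fun_prop) (by fun_prop)).inter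
    (isOpen_lt (by fun_prop) (by fun_prop))

lemma convex_simplexInt (d : ℕ) : Convex ℝ (simplexInt d) := by
  intro p hp r hr a b ha hb hab
  rw [mem_simplexInt_iff] at *
  refine ⟨fun i => convex_Ioi (0 : ℝ) (hp.1 i) (hr.1 i) ha hb hab, ?_⟩
  simpa only [Pi.add_apply, Pi.smul_apply, Finset.sum_add_distrib, ← Finset.smul_sum, Set.mem_Iio]
    using convex_Iio (1 : ℝ) hp.2 hr.2 ha hb hab

lemma strictConvexOn_inv_Ioi : StrictConvexOn ℝ (Set.Ioi (0 : ℝ)) fun x => x⁻¹ := by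
  simpa using strictConvexOn_zpow (m := -1) (by norm_num) (by norm_num)

lemma strictConvexOn_recipSum {d : ℕ} {c : Fin d → ℝ} {e : ℝ} (hc : ∀ i, 0 < c i) (he : 0 ≤ e) :
    StrictConvexOn ℝ (simplexInt d) (recipSum c e) := by
  refine ⟨convex_simplexInt d, fun p hp r hr hne a b ha hb hab => ?_⟩
  rw [mem_simplexInt_iff] at hp hr
  obtain ⟨k, hk⟩ := Function.ne_iff.mp hne
  have hsum : ∑ i, c i * ((a • p + b • r) i)⁻¹ <
      a * ∑ i, c i * (p i)⁻¹ + b * ∑ i, c i * (r i)⁻¹ := by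
    rw [Finset.mul_sum, Finset.mul_sum, ← Finset.sum_add_distrib]
    refine Finset.sum_lt_sum (fun i _ => ?_) ⟨k, Finset.mem_univ k, ?_⟩
    · have h := strictConvexOn_inv_Ioi.convexOn.2 (hp.1 i) (hr.1 i) ha.le hb.le hab
      have := mul_le_mul_of_nonneg_left h (hc i).le
      simp only [smul_eq_mul, Pi.add_apply, Pi.smul_apply] at this ⊢
      linarith
    · have h := strictConvexOn_inv_Ioi.2 (hp.1 k) (hr.1 k) hk ha hb hab
      have := mul_lt_mul_of_pos_left h (hc k)
      simp only [smul_eq_mul, Pi.add_apply, Pi.smul_apply] at this ⊢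
      linarith
  have hlast : e * (1 - ∑ i, (a • p + b • r) i)⁻¹ ≤
      a * (e * (1 - ∑ i, p i)⁻¹) + b * (e * (1 - ∑ i, r i)⁻¹) := by
    have h := strictConvexOn_inv_Ioi.convexOn.2 (sub_pos.2 hp.2) (sub_pos.2 hr.2) ha.le hb.le hab
    have := mul_le_mul_of_nonneg_left h he
    have hs : 1 - ∑ i, (a • p + b • r) i = a • (1 - ∑ i, p i) + b • (1 - ∑ i, r i) := by
      simp only [Pi.add_apply, Pi.smul_apply, smul_eq_mul, Finset.sum_add_distrib,
        ← Finset.mul_sum]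
      linear_combination -hab
    rw [hs]
    simp only [smul_eq_mul] at this ⊢
    linarith
  simp only [recipSum, smul_eq_mul]
  linarith

lemma hasFDerivAt_one_sub_sum {d : ℕ} (p : Fin d → ℝ) :
    HasFDerivAt (fun p : Fin d → ℝ => 1 - ∑ i, p i)
      (-∑ i, ContinuousLinearMap.proj (R := ℝ) (φ := fun _ : Fin d => ℝ) i) p :=
  (HasFDerivAt.fun_sum fun i _ => hasFDerivAt_apply i p).const_sub 1

lemma hasFDerivAt_recipSum {d : ℕ} (c : Fin d → ℝ) (e : ℝ) {p : Fin d → ℝ}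
    (hp : p ∈ simplexInt d) :
    HasFDerivAt (recipSum c e)
      (∑ i, (-(c i * (p i ^ 2)⁻¹)) • ContinuousLinearMap.proj (R := ℝ) (φ := fun _ : Fin d => ℝ) i +
        (e * ((1 - ∑ i, p i) ^ 2)⁻¹) •
          ∑ i, ContinuousLinearMap.proj (R := ℝ) (φ := fun _ : Fin d => ℝ) i) p := by
  rw [mem_simplexInt_iff] at hp
  refine HasFDerivAt.add (HasFDerivAt.fun_sum fun i _ => ?_) ?_
  · refine (((hasDerivAt_inv (hp.1 i).ne').comp_hasFDerivAt p
      (hasFDerivAt_apply i p)).const_mul (c i)).congr_fderiv ?_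
    rw [smul_smul, mul_neg]
  · refine (((hasDerivAt_inv (sub_pos.2 hp.2).ne').comp_hasFDerivAt p
      (hasFDerivAt_one_sub_sum p)).const_mul e).congr_fderiv ?_
    simp [smul_smul]

lemma hasDerivAt_inv_sq {x : ℝ} (hx : x ≠ 0) :
    HasDerivAt (fun x : ℝ => (x ^ 2)⁻¹) (-(2 * (x ^ 3)⁻¹)) x := by
  refine ((hasDerivAt_pow 2 x).fun_inv (pow_ne_zero 2 hx)).congr_deriv ?_
  field_simp
  norm_num [mul_comm]

lemma fderiv_fderiv_recipSum {d : ℕ} (c : Fin d → ℝ) (e : ℝ) {p : Fin d → ℝ}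
    (hp : p ∈ simplexInt d) (u v : Fin d → ℝ) :
    fderiv ℝ (fderiv ℝ (recipSum c e)) p u v =
      ∑ i, 2 * c i * (p i ^ 3)⁻¹ * (u i * v i) +
        2 * e * ((1 - ∑ i, p i) ^ 3)⁻¹ * ((∑ i, u i) * ∑ i, v i) := by
  have hev := Filter.eventually_of_mem ((isOpen_simplexInt d).mem_nhds hp)
    fun q hq => (hasFDerivAt_recipSum c e hq).fderiv
  rw [mem_simplexInt_iff] at hp
  have h1 := HasFDerivAt.fun_sum (u := Finset.univ) fun (i : Fin d) _ =>
    ((((hasDerivAt_inv_sq (hp.1 i).ne').comp_hasFDerivAt p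
      (hasFDerivAt_apply (𝕜 := ℝ) i p)).const_mul (c i)).fun_neg).smul_const
        (ContinuousLinearMap.proj (R := ℝ) (φ := fun _ : Fin d => ℝ) i)
  have h2 := (((hasDerivAt_inv_sq (sub_pos.2 hp.2).ne').comp_hasFDerivAt p
      (hasFDerivAt_one_sub_sum p)).const_mul e).smul_const
        (∑ i, ContinuousLinearMap.proj (R := ℝ) (φ := fun _ : Fin d => ℝ) i)
  rw [Filter.EventuallyEq.fderiv_eq hev]
  have h3 := (h1.fun_add h2).fderiv
  simp only [Function.comp_def] at h3
  rw [h3]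
  simp only [_root_.add_apply, _root_.sum_apply,
    ContinuousLinearMap.smulRight_apply, _root_.neg_apply,
    _root_.smul_apply, ContinuousLinearMap.proj_apply, smul_eq_mul]
  congr 1
  · exact Finset.sum_congr rfl fun i _ => by ring
  · ring

lemma sum_sq_sub_div_extP {d : ℕ} (q : Fin d → ℝ) {p : Fin d → ℝ} (hp : p ∈ simplexInt d) :
    ∑ i, (extP d q i - extP d p i) ^ 2 / extP d p i =
      recipSum (fun i => q i ^ 2) ((1 - ∑ i, q i) ^ 2) p - 1 := by
  rw [mem_simplexInt_iff] at hp
  have key : ∀ x y : ℝ, 0 < y → (x - y) ^ 2 / y = x ^ 2 * y⁻¹ - 2 * x + y := fun x y hy => by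
    field_simp
    ring
  simp only [Fin.sum_univ_castSucc, extP, Fin.snoc_castSucc, Fin.snoc_last, recipSum]
  rw [key _ _ (sub_pos.2 hp.2), Finset.sum_congr rfl fun i _ => key (q i) _ (hp.1 i),
    Finset.sum_add_distrib, Finset.sum_sub_distrib, ← Finset.mul_sum]
  ring

lemma pearsonHalf_eq_sum {d n : ℕ} (hn : 0 < n) (nh : Fin d → ℕ) {p : Fin d → ℝ}
    (hp : p ∈ simplexInt d) :
    pearsonHalf d n nh p = (n : ℝ) / 2 * ∑ i : Fin (d + 1),
      (extP d (fun j => (nh j : ℝ) / n) i - extP d p i) ^ 2 / extP d p i := by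
  rw [mem_simplexInt_iff] at hp
  have hn' : (0 : ℝ) < n := Nat.cast_pos.2 hn
  have hdel : ∀ i, delVec d n p (castK d nh) i = √n * ((nh i : ℝ) / n - p i) := fun i => by
    have hs : √(n : ℝ) ≠ 0 := (Real.sqrt_pos.2 hn').ne'
    rw [delVec, del, castK, div_eq_iff hs]
    field_simp
    rw [Real.sq_sqrt hn'.le, mul_comm]
  rw [pearsonHalf, quadForm_eq (fun i => (hp.1 i).ne') (sub_pos.2 hp.2).ne']
  simp only [hdel, ← Finset.mul_sum, mul_pow, Real.sq_sqrt hn'.le, mul_div_assoc,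
    Fin.sum_univ_castSucc, extP, Fin.snoc_castSucc, Fin.snoc_last, Finset.sum_sub_distrib]
  ring

lemma pearsonHalf_eq_recipSum {d n : ℕ} (hn : 0 < n) (nh : Fin d → ℕ) {p : Fin d → ℝ}
    (hp : p ∈ simplexInt d) :
    pearsonHalf d n nh p =
      recipSum (fun i => (n : ℝ) / 2 * ((nh i : ℝ) / n) ^ 2)
        ((n : ℝ) / 2 * (1 - ∑ i, (nh i : ℝ) / n) ^ 2) p - n / 2 := by
  rw [pearsonHalf_eq_sum hn nh hp, sum_sq_sub_div_extP _ hp]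
  simp only [recipSum, mul_assoc, ← Finset.mul_sum]
  ring

lemma posDef_hessM {d n : ℕ} {nh : Fin d → ℕ} (hn : 0 < n) (hpos : ∀ i, 0 < nh i)
    {p : Fin d → ℝ} (hp : p ∈ simplexInt d) : (hessM d n nh p).PosDef := by
  rw [mem_simplexInt_iff] at hp
  have hn' : (0 : ℝ) < n := Nat.cast_pos.2 hn
  refine Matrix.PosDef.smul (Matrix.PosDef.add_posSemidef (Matrix.PosDef.diagonal fun i => ?_)
    (Matrix.PosSemidef.smul ?_ ?_)) hn'
  · have := hp.1 i
    have : (0 : ℝ) < nh i := Nat.cast_pos.2 (hpos i)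
    positivity
  · simpa using! Matrix.posSemidef_vecMulVec_self_star (fun _ : Fin d => (1 : ℝ))
  · have := sub_pos.2 hp.2
    positivity

/-- **Strict convexity of `p ↦ ½ δ_{n̂,p}ᵀ Σ_p⁻¹ δ_{n̂,p}`, identification with
`(n/2) ∑_{i=1}^{d+1} (p̂_i - p_i)²/p_i`, and positive definiteness of its Hessian.** -/
theorem stmt8 (d n : ℕ) (nh : Fin d → ℕ) (hpos : ∀ i, 0 < nh i) (hsum : ∑ i, nh i < n) :
    (∀ p ∈ simplexInt d,
      pearsonHalf d n nh p =
        (n : ℝ) / 2 * ∑ i : Fin (d + 1),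
          (extP d (fun j => (nh j : ℝ) / n) i - extP d p i) ^ 2 / extP d p i) ∧
    StrictConvexOn ℝ (simplexInt d) (pearsonHalf d n nh) ∧
    ∀ p : Fin d → ℝ, (∀ i, 0 < p i) → ∑ i, p i < 1 →
      (∀ i j : Fin d,
        iteratedFDeriv ℝ 2 (pearsonHalf d n nh) p ![Pi.single i 1, Pi.single j 1] =
          hessM d n nh p i j) ∧
      (hessM d n nh p).PosDef := by
  have hn : 0 < n := (Nat.zero_le _).trans_lt hsum
  have hn' : (0 : ℝ) < n := Nat.cast_pos.2 hn
  refine ⟨fun p hp => pearsonHalf_eq_sum hn nh hp, ?_, fun p hp hps => ?_⟩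
  · refine StrictConvexOn.congr ((strictConvexOn_recipSum (fun i => ?_) ?_).add_const _)
      fun p hp => ((pearsonHalf_eq_recipSum hn nh hp).trans (sub_eq_add_neg _ _)).symm
    · have : (0 : ℝ) < nh i := Nat.cast_pos.2 (hpos i)
      positivity
    · positivity
  · have hmem : p ∈ simplexInt d := mem_simplexInt_iff.2 ⟨hp, hps⟩
    refine ⟨fun i j => ?_, posDef_hessM hn hpos hmem⟩
    change _ = (n : ℝ) * ((if i = j then ((nh i : ℝ) / n) ^ 2 / p i ^ 3 else 0) +
      (1 - ∑ i, (nh i : ℝ) / n) ^ 2 / (1 - ∑ i, p i) ^ 3 * (1 * 1))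
    have hev := Filter.eventually_of_mem ((isOpen_simplexInt d).mem_nhds hmem)
      fun q hq => pearsonHalf_eq_recipSum hn nh hq
    have hfderiv := (Filter.EventuallyEq.fderiv hev).trans
      (Filter.Eventually.of_forall fun _ => fderiv_sub_const (𝕜 := ℝ) (E := Fin d → ℝ) _)
    rw [iteratedFDeriv_two_apply, hfderiv.fderiv_eq,
      fderiv_fderiv_recipSum _ _ hmem]
    simp only [Matrix.cons_val_zero, Matrix.cons_val_one, Pi.single_apply, Finset.sum_ite_eq',
      Finset.mem_univ, if_true, mul_ite, mul_zero, mul_one]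
    generalize 1 - ∑ i, (nh i : ℝ) / n = s
    obtain rfl | hij := eq_or_ne i j
    · simp only [if_true]
      ring
    · simp only [hij, hij.symm, if_false]
      ring
end
end

section
/- Let n ∈ ℕ with n ≥ 16, d ∈ ℕ, p ∈ S_d^o, and let ξ = (ξ_1,…,ξ_d) ~ Multinomial(n,p) with ξ_{d+1} := n − ‖ξ‖₁ and p_{d+1} := 1 − ‖p‖₁. Then for every Borel set B ⊆ ℝ^d and all 1 ≤ i ≤ d+1, | E[ δ_{ξ_i,p_i} · 1_{{ξ ∈ B}} ] | ≤ (1/2) ( P(ξ ∈ B^c) )^{1/2}, where δ_{ξ_i,p_i} := (ξ_i − n p_i)/√n. -/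
open MeasureTheory Matrix Real Finset
open scoped BigOperators ENNReal NNReal

noncomputable section

/-- The multinomial weight of the count vector `m` for the cell weights `q`. -/
def multinomialWeight {ι : Type*} [Fintype ι] (q : ι → ℝ) (m : ι → ℕ) : ℝ :=
  (Nat.multinomial univ m : ℝ) * ∏ j, q j ^ m j

theorem multinomialWeight_nonneg {ι : Type*} [Fintype ι] {q : ι → ℝ} (hq : ∀ j, 0 ≤ q j)
    (m : ι → ℕ) : 0 ≤ multinomialWeight q m :=
  mul_nonneg (Nat.cast_nonneg _) (prod_nonneg fun j _ => pow_nonneg (hq j) _)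

section Moments

variable {ι : Type*} [Fintype ι] [DecidableEq ι] {q : ι → ℝ}

open Polynomial in
/-- The probability generating function of one coordinate. -/
theorem multinomial_genFun (hq : ∑ j, q j = 1) (n : ℕ) (i : ι) :
    ∑ m ∈ piAntidiag univ n, C (multinomialWeight q m) * X ^ m i =
      (C (1 - q i) + C (q i) * X) ^ n := by
  have h : (C (1 - q i) + C (q i) * X : ℝ[X]) =
      ∑ j, C (q j) * (if j = i then X else 1) := by
    have hj (j : ι) : C (q j) * (if j = i then X else 1) =
        C (q j) + if j = i then C (q j) * (X - 1) else 0 := by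
      split_ifs <;> ring
    simp only [hj, sum_add_distrib, sum_ite_eq', mem_univ, if_true, ← map_sum, hq, map_sub]
    ring
  rw [h, sum_pow_eq_sum_piAntidiag]
  refine sum_congr rfl fun m _ => ?_
  simp only [multinomialWeight, mul_pow, prod_mul_distrib, ite_pow, one_pow, prod_ite_eq',
    mem_univ, if_true, map_mul, map_prod, map_pow, map_natCast, mul_assoc]

theorem sum_multinomialWeight (hq : ∑ j, q j = 1) (n : ℕ) :
    ∑ m ∈ piAntidiag univ n, multinomialWeight q m = 1 := by
  have h := sum_pow_eq_sum_piAntidiag univ q n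
  rw [hq, one_pow] at h
  exact h.symm

theorem sum_multinomialWeight_mul (hq : ∑ j, q j = 1) (n : ℕ) (i : ι) :
    ∑ m ∈ piAntidiag univ n, multinomialWeight q m * m i = n * q i := by
  have h := congrArg (fun f => (Polynomial.derivative f).eval 1) (multinomial_genFun hq n i)
  simpa [Polynomial.eval_finsetSum, Polynomial.derivative_pow] using h

theorem sum_multinomialWeight_mul_pred (hq : ∑ j, q j = 1) (n : ℕ) (i : ι) :
    ∑ m ∈ piAntidiag univ n, multinomialWeight q m * (m i * (m i - 1 : ℝ)) =
      n * (n - 1) * q i ^ 2 := by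
  have hpred (a : ℕ) : (a : ℝ) * ((a - 1 : ℕ) : ℝ) = a * (a - 1) := by
    cases a <;> simp
  have h := congrArg (fun f => (Polynomial.derivative (Polynomial.derivative f)).eval 1)
    (multinomial_genFun hq n i)
  simp [Polynomial.eval_finsetSum, Polynomial.derivative_pow, hpred] at h
  rw [h, ← hpred]
  ring

theorem sum_multinomialWeight_mul_centered (hq : ∑ j, q j = 1) (n : ℕ) (i : ι) :
    ∑ m ∈ piAntidiag univ n, multinomialWeight q m * (m i - n * q i : ℝ) = 0 := by
  simp only [mul_sub, sum_sub_distrib, ← sum_mul, sum_multinomialWeight_mul hq,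
    sum_multinomialWeight hq]
  ring

theorem sum_multinomialWeight_mul_centered_sq (hq : ∑ j, q j = 1) (n : ℕ) (i : ι) :
    ∑ m ∈ piAntidiag univ n, multinomialWeight q m * (m i - n * q i : ℝ) ^ 2 =
      n * (q i * (1 - q i)) := by
  have h (m : ι → ℕ) : multinomialWeight q m * (m i - n * q i : ℝ) ^ 2 =
      multinomialWeight q m * (m i * (m i - 1 : ℝ)) +
        multinomialWeight q m * m i * (1 - 2 * (n * q i)) +
        multinomialWeight q m * (n * q i) ^ 2 := by ring
  simp only [h, sum_add_distrib, ← sum_mul, sum_multinomialWeight_mul_pred hq,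
    sum_multinomialWeight_mul hq, sum_multinomialWeight hq]
  ring

end Moments

section Reindexing

variable {d : ℕ} {p : Fin d → ℝ}

theorem extP_nonneg (hp : p ∈ simplexInt d) (j : Fin (d + 1)) : 0 ≤ extP d p j := by
  refine Fin.lastCases ?_ (fun j => ?_) j
  · simpa [extP] using hp.2.le
  · simpa [extP] using (hp.1 j).1.le

theorem sum_extP (p : Fin d → ℝ) : ∑ j, extP d p j = 1 := by
  simp [extP, Fin.sum_univ_castSucc]

theorem extV_castK_init {n : ℕ} {m : Fin (d + 1) → ℕ} (hm : ∑ j, m j = n) :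
    extV d n (castK d (Fin.init m)) = fun j => (m j : ℝ) := by
  subst hm
  funext j
  refine Fin.lastCases ?_ (fun j => ?_) j <;>
    simp [extV, castK, Fin.init, Fin.sum_univ_castSucc]

theorem multinomialPMF_init {n : ℕ} {m : Fin (d + 1) → ℕ} (hm : ∑ j, m j = n) :
    multinomialPMF d n p (Fin.init m) = multinomialWeight (extP d p) m := by
  have hlast : n - ∑ j, Fin.init m j = m (Fin.last d) := by
    rw [← hm, Fin.sum_univ_castSucc]
    exact Nat.add_sub_cancel_left _ _
  have hle : ∑ j, Fin.init m j ≤ n := by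
    rw [← hm, Fin.sum_univ_castSucc]
    exact Nat.le_add_right _ _
  rw [multinomialPMF, if_pos hle, hlast, multinomialWeight, Nat.multinomial, hm,
    Nat.cast_div (by rw [← hm]; exact Nat.prod_factorial_dvd_factorial_sum _ _)
      (by exact_mod_cast (prod_pos fun j _ => Nat.factorial_pos (m j)).ne')]
  simp [Fin.prod_univ_castSucc, extP, Fin.init]

theorem tsum_multinomialPMF_mul (n : ℕ) (p : Fin d → ℝ) (g : (Fin d → ℕ) → ℝ) :
    ∑' k, multinomialPMF d n p k * g k =
      ∑ m ∈ piAntidiag (univ : Finset (Fin (d + 1))) n,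
        multinomialWeight (extP d p) m * g (Fin.init m) := by
  have hinj : Set.InjOn (Fin.init : (Fin (d + 1) → ℕ) → Fin d → ℕ)
      (piAntidiag (univ : Finset (Fin (d + 1))) n) := by
    intro a ha b hb hab
    have ha' : ∑ j, a j = n := (mem_piAntidiag.1 ha).1
    have hb' : ∑ j, b j = n := (mem_piAntidiag.1 hb).1
    have h := (extV_castK_init ha').symm.trans (hab ▸ extV_castK_init hb')
    exact funext fun j => Nat.cast_injective (congrFun h j)
  rw [tsum_eq_sum (s := (piAntidiag (univ : Finset (Fin (d + 1))) n).image Fin.init),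
    sum_image hinj]
  · exact sum_congr rfl fun m hm => by rw [multinomialPMF_init (mem_piAntidiag.1 hm).1]
  · intro k hk
    rw [multinomialPMF, if_neg, zero_mul]
    intro hle
    refine hk (mem_image.2 ⟨Fin.snoc k (n - ∑ j, k j), ?_, Fin.init_snoc _ _⟩)
    simp [mem_piAntidiag, Fin.sum_univ_castSucc, hle]

end Reindexing

/-- **Lemma (first truncated moment bound for the multinomial distribution).** -/
theorem stmt11 (d n : ℕ) (hn : 16 ≤ n) (p : Fin d → ℝ) (hp : p ∈ simplexInt d)
    (B : Set (Fin d → ℝ)) (hB : MeasurableSet B) (i : Fin (d + 1)) :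
    |∑' k : Fin d → ℕ, multinomialPMF d n p k *
        del n (extP d p i) (extV d n (castK d k) i) *
        Set.indicator B (fun _ => (1 : ℝ)) (castK d k)| ≤
      (1 / 2) * (∑' k : Fin d → ℕ, multinomialPMF d n p k *
        Set.indicator Bᶜ (fun _ => (1 : ℝ)) (castK d k)) ^ ((1 : ℝ) / 2) := by
  classical
  have hq := sum_extP p
  have hn0 : (0 : ℝ) < n := by exact_mod_cast (by omega : 0 < n)
  set q := extP d p with hqdef
  set A := piAntidiag (univ : Finset (Fin (d + 1))) n
  let w := multinomialWeight q
  have hw (m) : 0 ≤ w m := multinomialWeight_nonneg (extP_nonneg hp) m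
  let b : (Fin (d + 1) → ℕ) → ℝ := fun m =>
    Set.indicator B (fun _ => (1 : ℝ)) (castK d (Fin.init m))
  let c : (Fin (d + 1) → ℕ) → ℝ := fun m =>
    Set.indicator Bᶜ (fun _ => (1 : ℝ)) (castK d (Fin.init m))
  let δ : (Fin (d + 1) → ℕ) → ℝ := fun m => del n (q i) (m i)
  have hc (m) : 0 ≤ c m := Set.indicator_nonneg (fun _ _ => zero_le_one) _
  have hcc (m) : c m ^ 2 = c m := by
    by_cases h : castK d (Fin.init m) ∈ B <;> simp [c, h]
  have hbc (m) : b m = 1 - c m := by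
    by_cases h : castK d (Fin.init m) ∈ B <;> simp [b, c, h]
  have hmean : ∑ m ∈ A, w m * δ m = 0 := by
    simp only [δ, del, ← mul_div_assoc, ← sum_div]
    rw [sum_multinomialWeight_mul_centered hq, zero_div]
  have hvar : ∑ m ∈ A, w m * δ m ^ 2 ≤ 1 / 4 := by
    simp only [δ, del, div_pow, Real.sq_sqrt hn0.le, ← mul_div_assoc, ← sum_div]
    rw [sum_multinomialWeight_mul_centered_sq hq, mul_div_cancel_left₀ _ hn0.ne']
    nlinarith [sq_nonneg (q i - 1 / 2)]
  have hleft : ∑' k : Fin d → ℕ, multinomialPMF d n p k * del n (q i) (extV d n (castK d k) i) *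
      Set.indicator B (fun _ => (1 : ℝ)) (castK d k) = -∑ m ∈ A, w m * δ m * c m := by
    simp only [mul_assoc]
    rw [tsum_multinomialPMF_mul, eq_neg_iff_add_eq_zero, ← sum_add_distrib, ← hmean]
    refine sum_congr rfl fun m hm => ?_
    rw [extV_castK_init (mem_piAntidiag.1 hm).1]
    change w m * (δ m * b m) + w m * (δ m * c m) = w m * δ m
    rw [hbc]
    ring
  rw [hleft, tsum_multinomialPMF_mul, abs_neg, ← Real.sqrt_eq_rpow]
  change |∑ m ∈ A, w m * δ m * c m| ≤ 1 / 2 * √(∑ m ∈ A, w m * c m)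
  have hP : 0 ≤ ∑ m ∈ A, w m * c m := sum_nonneg fun m _ => mul_nonneg (hw m) (hc m)
  have hCS : (∑ m ∈ A, w m * δ m * c m) ^ 2 ≤
      (∑ m ∈ A, w m * δ m ^ 2) * ∑ m ∈ A, w m * c m :=
    sum_sq_le_sum_mul_sum_of_sq_le_mul A (fun m _ => mul_nonneg (hw m) (sq_nonneg _))
      (fun m _ => mul_nonneg (hw m) (hc m)) fun m _ => by
        rw [mul_pow, hcc]
        exact le_of_eq (by ring)
  refine abs_le_of_sq_le_sq (hCS.trans ?_) (by positivity)
  rw [mul_pow, Real.sq_sqrt hP]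
  exact mul_le_mul_of_nonneg_right (hvar.trans_eq (by norm_num)) hP
end
end
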